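/- Let (M,𝓕) be a transversely oriented Riemannian foliation of codimension q on a closed manifold with a bundle-like metric, let θ be a closed basic one-form, and define the Lichnerowicz Laplacian Δ_θ = (δ_b − θ⌟)(d − θ∧) + (d − θ∧)(δ_b − θ⌟) on basic forms. Then for every basic k-form β, ∗̄ Δ_θ β = Δ_{κ_b−θ} ∗̄ β; hence ∗̄ maps Δ_θ-harmonic basic k-forms bijectively onto Δ_{κ_b−θ}-harmonic basic (q−k)-forms. -/

import Mathlib

noncomputable section

open scoped TensorProduct DirectSum

/-- An abstract model of the complex `Ω^•(M,𝓕)` of **basic differential forms** of a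
smooth foliation `𝓕` of leaf dimension `p` and codimension `q` on a closed manifold `M`,
together with the wedge product and the exterior derivative (which preserves basic
forms).  The field `A1` models the space of *all* (not necessarily basic) one-forms on
`M`, `inc` the inclusion of basic one-forms, and `Pos` the predicate "is a pointwise
positive basic function". -/
structure SmoothFoliation where
  p : ℕ
  q : ℕ
  Ω : ℕ → Type
  [nacg : ∀ k, NormedAddCommGroup (Ω k)]
  [nsm : ∀ k, NormedSpace ℝ (Ω k)]
  d : ∀ k, Ω k →ₗ[ℝ] Ω (k + 1)
  d_sq : ∀ k (α : Ω k), d (k + 1) (d k α) = 0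
  wedge : ∀ {k l n : ℕ}, k + l = n → (Ω k →ₗ[ℝ] Ω l →ₗ[ℝ] Ω n)
  one : Ω 0
  d_one : d 0 one = 0
  one_wedge : ∀ {k : ℕ} (α : Ω k), wedge (Nat.zero_add k) one α = α
  wedge_assoc : ∀ {a b c n : ℕ} (h : a + b + c = n) (α : Ω a) (β : Ω b) (γ : Ω c),
    wedge h (wedge rfl α β) γ = wedge (show a + (b + c) = n by omega) α (wedge rfl β γ)
  wedge_comm : ∀ {a b n : ℕ} (h : a + b = n) (α : Ω a) (β : Ω b),
    wedge h α β = ((-1 : ℝ)) ^ (a * b) • wedge (show b + a = n by omega) β α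
  leibniz : ∀ {a b n : ℕ} (h : a + b = n) (α : Ω a) (β : Ω b),
    d n (wedge h α β)
      = wedge (show a + 1 + b = n + 1 by omega) (d a α) β
        + ((-1 : ℝ)) ^ a • wedge (show a + (b + 1) = n + 1 by omega) α (d b β)
  degle : ∀ k, q < k → ∀ α : Ω k, α = 0
  A1 : Type
  [acgA : AddCommGroup A1]
  [modA : Module ℝ A1]
  inc : Ω 1 →ₗ[ℝ] A1
  inc_inj : Function.Injective inc
  Pos : Ω 0 → Prop
  pos_one : Pos one

attribute [instance] SmoothFoliation.nacg SmoothFoliation.nsm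
attribute [instance] SmoothFoliation.acgA SmoothFoliation.modA

namespace SmoothFoliation

variable (X : SmoothFoliation)

/-- Left wedge with a one-form: `θ ∧ ·`. -/
def lmul (θ : X.Ω 1) (k : ℕ) : X.Ω k →ₗ[ℝ] X.Ω (k + 1) :=
  X.wedge (show 1 + k = k + 1 by omega) θ

/-- The Lichnerowicz differential `d + θ∧` on basic forms. -/
def lich (θ : X.Ω 1) (k : ℕ) : X.Ω k →ₗ[ℝ] X.Ω (k + 1) :=
  X.d k + X.lmul θ k

/-- Cocycles of a differential `D` on basic forms. -/
def cocycles (D : ∀ k, X.Ω k →ₗ[ℝ] X.Ω (k + 1)) (k : ℕ) : Submodule ℝ (X.Ω k) :=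
  LinearMap.ker (D k)

/-- Coboundaries of a differential `D` on basic forms. -/
def cobound (D : ∀ k, X.Ω k →ₗ[ℝ] X.Ω (k + 1)) : ∀ k, Submodule ℝ (X.Ω k)
  | 0 => ⊥
  | (k + 1) => LinearMap.range (D k)

/-- Cohomology of the complex of basic forms with respect to the differential `D`. -/
abbrev cohomology (D : ∀ k, X.Ω k →ₗ[ℝ] X.Ω (k + 1)) (k : ℕ) :=
  ↥(X.cocycles D k) ⧸ (X.cobound D k).comap (X.cocycles D k).subtype

/-- The cohomology class of a cocycle. -/
def cls (D : ∀ k, X.Ω k →ₗ[ℝ] X.Ω (k + 1)) {k : ℕ} (α : X.Ω k)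
    (hα : α ∈ X.cocycles D k) : X.cohomology D k :=
  Submodule.Quotient.mk ⟨α, hα⟩

/-- Degree cast. -/
def castDeg {k l : ℕ} (h : k = l) : X.Ω k ≃ₗ[ℝ] X.Ω l := by
  subst h; exact LinearEquiv.refl ℝ (X.Ω k)

end SmoothFoliation

/-- A choice of bundle-like metric (together with transverse orientation data) on a
Riemannian foliation, modelled by the data and operators it induces on basic forms:
the full mean curvature one-form `κ`, the basic mean curvature `κb` (its `L²`-orthogonal
projection to basic one-forms, which is closed), the transversal Hodge star operator
`∗̄`, the `L²`-adjoint `δ_b` of `d` on basic forms, the interior products `θ⌟`, the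
transverse volume form `ν`, integration `α ↦ ∫_M α ∧ χ_𝓕` against the characteristic
form, the standard identities relating them, and the isomorphism
`∗̄ : H_{d−κ_b∧}^k(M,𝓕) → H_d^{q−k}(M,𝓕)` induced by `∗̄` via Hodge theory. -/
structure BundleLikeMetric (X : SmoothFoliation) where
  κ : X.A1
  κb : X.Ω 1
  κb_closed : X.d 1 κb = 0
  hstar : ∀ {k l : ℕ}, k + l = X.q → (X.Ω k ≃ₗ[ℝ] X.Ω l)
  δb : ∀ k, X.Ω (k + 1) →ₗ[ℝ] X.Ω k
  iota : ∀ k, X.Ω 1 →ₗ[ℝ] X.Ω (k + 1) →ₗ[ℝ] X.Ω k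
  ν : X.Ω X.q
  intχ : X.Ω X.q →ₗ[ℝ] ℝ
  hstar_hstar : ∀ {k l : ℕ} (h : k + l = X.q) (α : X.Ω k),
    hstar (show l + k = X.q by omega) (hstar h α) = ((-1 : ℝ)) ^ (k * l) • α
  δb_hstar : ∀ {k l : ℕ} (h : k + (l + 1) = X.q) (α : X.Ω k),
    δb l (hstar h α)
      = ((-1 : ℝ)) ^ (k + 1) • hstar (show k + 1 + l = X.q by omega) (X.lich (-κb) k α)
  hstar_δb : ∀ {k l : ℕ} (h : k + 1 + l = X.q) (α : X.Ω (k + 1)),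
    hstar (show k + (l + 1) = X.q by omega) (δb k α)
      = ((-1 : ℝ)) ^ (k + 1) • X.lich (-κb) l (hstar h α)
  iota_hstar : ∀ {k l : ℕ} (h : k + (l + 1) = X.q) (θ : X.Ω 1) (α : X.Ω k),
    iota l θ (hstar h α)
      = ((-1 : ℝ)) ^ k • hstar (show k + 1 + l = X.q by omega) (X.lmul θ k α)
  hstar_iota : ∀ {k l : ℕ} (h : k + 1 + l = X.q) (θ : X.Ω 1) (α : X.Ω (k + 1)),
    hstar (show k + (l + 1) = X.q by omega) (iota k θ α)
      = ((-1 : ℝ)) ^ k • X.lmul θ l (hstar h α)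
  hstarCoh : ∀ {k l : ℕ}, k + l = X.q →
    (X.cohomology (X.lich (-κb)) k ≃ₗ[ℝ] X.cohomology X.d l)

namespace SmoothFoliation

variable (X : SmoothFoliation)

/-- The twisted differential `d̃ = d − (1/2) κ_b ∧`. -/
def twistD (m : BundleLikeMetric X) : ∀ k, X.Ω k →ₗ[ℝ] X.Ω (k + 1) :=
  X.lich (-((1 / 2 : ℝ) • m.κb))

/-- The twisted codifferential `δ̃ = δ_b − (1/2) κ_b ⌟`. -/
def twistδ (m : BundleLikeMetric X) (k : ℕ) : X.Ω (k + 1) →ₗ[ℝ] X.Ω k :=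
  m.δb k - (1 / 2 : ℝ) • m.iota k m.κb

/-- The twisted basic Laplacian `Δ̃ = d̃ δ̃ + δ̃ d̃`. -/
def twistLap (m : BundleLikeMetric X) : ∀ k, X.Ω k →ₗ[ℝ] X.Ω k
  | 0 => (X.twistδ m 0).comp (X.twistD m 0)
  | (k + 1) =>
      (X.twistD m k).comp (X.twistδ m k) + (X.twistδ m (k + 1)).comp (X.twistD m (k + 1))

/-- The codifferential `δ_b − θ⌟` of the Lichnerowicz differential `d − θ∧`. -/
def lichδ (m : BundleLikeMetric X) (θ : X.Ω 1) (k : ℕ) : X.Ω (k + 1) →ₗ[ℝ] X.Ω k :=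
  m.δb k - m.iota k θ

/-- The Lichnerowicz Laplacian `Δ_θ = (δ_b − θ⌟)(d − θ∧) + (d − θ∧)(δ_b − θ⌟)`. -/
def lichLap (m : BundleLikeMetric X) (θ : X.Ω 1) : ∀ k, X.Ω k →ₗ[ℝ] X.Ω k
  | 0 => (X.lichδ m θ 0).comp (X.lich (-θ) 0)
  | (k + 1) =>
      (X.lich (-θ) k).comp (X.lichδ m θ k) + (X.lichδ m θ (k + 1)).comp (X.lich (-θ) (k + 1))

/-- The complexification of the total space of basic forms. -/
abbrev cxTotal : Type := ⨁ k : Fin (X.q + 1), (ℂ ⊗[ℝ] X.Ω (k : ℕ))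

/-- The operator `★ = i^{k(k−1)+q/2} ∗̄` on complexified basic `k`-forms. -/
def starC (m : BundleLikeMetric X) : X.cxTotal →ₗ[ℂ] X.cxTotal :=
  DirectSum.toModule ℂ (Fin (X.q + 1)) X.cxTotal fun k =>
    (DirectSum.lof ℂ (Fin (X.q + 1)) (fun j => ℂ ⊗[ℝ] X.Ω (j : ℕ))
        ⟨X.q - (k : ℕ), by omega⟩).comp
      ((Complex.I ^ ((k : ℕ) * ((k : ℕ) - 1) + X.q / 2)) •
        LinearMap.baseChange ℂ
          (m.hstar (show (k : ℕ) + (X.q - (k : ℕ)) = X.q by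
            have := k.isLt; omega)).toLinearMap)

/-- The complexified twisted basic Laplacian on the total space of basic forms. -/
def lapC (m : BundleLikeMetric X) : X.cxTotal →ₗ[ℂ] X.cxTotal :=
  DirectSum.toModule ℂ (Fin (X.q + 1)) X.cxTotal fun k =>
    (DirectSum.lof ℂ (Fin (X.q + 1)) (fun j => ℂ ⊗[ℝ] X.Ω (j : ℕ)) k).comp
      (LinearMap.baseChange ℂ (X.twistLap m (k : ℕ)))

/-- The basic signature `σ(M,𝓕) = dim ker (Δ̃|_{Ω^+}) − dim ker (Δ̃|_{Ω^−})`, where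
`Ω^±` are the `±1`-eigenspaces of `★`. -/
def basicSignature (m : BundleLikeMetric X) : ℤ :=
  (Module.finrank ℂ
      ↥(LinearMap.ker (X.lapC m) ⊓ LinearMap.ker (X.starC m - LinearMap.id)) : ℤ)
    - (Module.finrank ℂ
      ↥(LinearMap.ker (X.lapC m) ⊓ LinearMap.ker (X.starC m + LinearMap.id)) : ℤ)

end SmoothFoliation

/-- A smooth foliated map `f : (M,𝓕) → (M',𝓕')` (i.e. `f_*(T𝓕) ⊆ T𝓕'`), modelled by
the pullback `f^*` it induces from basic forms on `M'` to basic forms on `M`, which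
commutes with `d` and with wedge products. -/
structure FoliatedMap (X X' : SmoothFoliation) where
  pull : ∀ k, X'.Ω k →ₗ[ℝ] X.Ω k
  pull_d : ∀ k (α : X'.Ω k), pull (k + 1) (X'.d k α) = X.d k (pull k α)
  pull_wedge : ∀ {k l n : ℕ} (h : k + l = n) (α : X'.Ω k) (β : X'.Ω l),
    pull n (X'.wedge h α β) = X.wedge h (pull k α) (pull l β)
  pull_one : pull 0 X'.one = X.one

/-- The identity, as a foliated map. -/
def FoliatedMap.id (X : SmoothFoliation) : FoliatedMap X X where
  pull _ := LinearMap.id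
  pull_d _ _ := rfl
  pull_wedge _ _ _ := rfl
  pull_one := rfl

/-- The composite `g ∘ f : (M,𝓕) → (M'',𝓕'')` of foliated maps, with pullback
`f^* ∘ g^*`. -/
def FoliatedMap.comp {X X' X'' : SmoothFoliation}
    (f : FoliatedMap X X') (g : FoliatedMap X' X'') : FoliatedMap X X'' where
  pull k := (f.pull k).comp (g.pull k)
  pull_d k α := by simp only [LinearMap.comp_apply, g.pull_d, f.pull_d]
  pull_wedge h α β := by simp only [LinearMap.comp_apply, g.pull_wedge, f.pull_wedge]
  pull_one := by simp only [LinearMap.comp_apply, g.pull_one, f.pull_one]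

/-- A smooth foliated homotopy `H : [0,1] × M → M'` between the foliated maps
`φ = H(0,·)` and `ψ = H(1,·)`, modelled by the family of pullbacks `P t = H(t,·)^*`
together with the insertion operators `ins t : σ ↦ j_t^*(∂_t ⌟ H^*σ)`, satisfying
Cartan's homotopy formula  `d/dt H(t,·)^*σ = d (ins t σ) + ins t (dσ)`. -/
structure FoliatedHomotopy (X X' : SmoothFoliation) (φ ψ : FoliatedMap X X') where
  P : ℝ → FoliatedMap X X'
  P0 : P 0 = φ
  P1 : P 1 = ψ
  ins : ℝ → ∀ k, X'.Ω (k + 1) →ₗ[ℝ] X.Ω k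
  cartan0 : ∀ (t : ℝ) (g : X'.Ω 0),
    HasDerivAt (fun u : ℝ => (P u).pull 0 g) (ins t 0 (X'.d 0 g)) t
  cartan : ∀ (t : ℝ) (k : ℕ) (σ : X'.Ω (k + 1)),
    HasDerivAt (fun u : ℝ => (P u).pull (k + 1) σ)
      (X.d k (ins t k σ) + ins t (k + 1) (X'.d (k + 1) σ)) t
  contP : ∀ (k : ℕ) (σ : X'.Ω k), Continuous fun t : ℝ => (P t).pull k σ
  contIns : ∀ (k : ℕ) (σ : X'.Ω (k + 1)), Continuous fun t : ℝ => ins t k σ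

/-- A foliated homotopy equivalence `f : (M,𝓕) → (M',𝓕')`:  a foliated map `f` with a
foliated map `g : M' → M` such that `g ∘ f` and `f ∘ g` are foliated homotopic to the
respective identity maps. -/
structure FoliatedHomotopyEquiv (X X' : SmoothFoliation) where
  f : FoliatedMap X X'
  g : FoliatedMap X' X
  h1 : FoliatedHomotopy X X (FoliatedMap.comp f g) (FoliatedMap.id X)
  h2 : FoliatedHomotopy X' X' (FoliatedMap.comp g f) (FoliatedMap.id X')

namespace SmoothFoliation

/-- Wedge powers of a basic function. -/
def wpow (X : SmoothFoliation) (x : X.Ω 0) : ℕ → X.Ω 0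
  | 0 => X.one
  | (n + 1) => X.wedge rfl x (X.wpow x n)

/-- The exponential of a basic function. -/
def exp0 (X : SmoothFoliation) (x : X.Ω 0) : X.Ω 0 :=
  ∑' n : ℕ, ((n.factorial : ℝ))⁻¹ • X.wpow x n

end SmoothFoliation

/-- `a_t = exp (∫_0^t j_s^*(∂_t ⌟ H^*θ') ds)`. -/
def FoliatedHomotopy.aFun {X X' : SmoothFoliation} {φ ψ : FoliatedMap X X'}
    (H : FoliatedHomotopy X X' φ ψ) (θ : X'.Ω 1) (t : ℝ) : X.Ω 0 :=
  X.exp0 (∫ s in (0:ℝ)..t, H.ins s 0 θ)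

/-- `h(σ) = ∫_0^1 a_s · j_s^*(∂_t ⌟ H^*σ) ds`. -/
def FoliatedHomotopy.hMap {X X' : SmoothFoliation} {φ ψ : FoliatedMap X X'}
    (H : FoliatedHomotopy X X' φ ψ) (θ : X'.Ω 1) (k : ℕ) (σ : X'.Ω (k + 1)) : X.Ω k :=
  ∫ s in (0:ℝ)..(1:ℝ), X.wedge (Nat.zero_add k) (H.aFun θ s) (H.ins s k σ)

/-- The dimension of a maximal positive-definite subspace for the bilinear form `B`. -/
def posIndex {V : Type*} [AddCommGroup V] [Module ℝ V]
    (B : V →ₗ[ℝ] V →ₗ[ℝ] ℝ) : ℕ :=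
  sSup {n : ℕ | ∃ W : Submodule ℝ V, Module.finrank ℝ W = n ∧ ∀ x ∈ W, x ≠ 0 → 0 < B x x}

/-- The signature of a bilinear form `B`. -/
def bilinSignature {V : Type*} [AddCommGroup V] [Module ℝ V]
    (B : V →ₗ[ℝ] V →ₗ[ℝ] ℝ) : ℤ :=
  (posIndex B : ℤ) - (posIndex (-B) : ℤ)

namespace BundleLikeMetric

variable {X : SmoothFoliation} (m : BundleLikeMetric X)

lemma hstar_lichδ (θ : X.Ω 1) {k l : ℕ} (h : k + 1 + l = X.q) (α : X.Ω (k + 1)) :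
    m.hstar (show k + (l + 1) = X.q by omega) (X.lichδ m θ k α)
      = (-1 : ℝ) ^ (k + 1) • X.lich (-(m.κb - θ)) l (m.hstar h α) := by
  simp only [SmoothFoliation.lichδ, LinearMap.sub_apply, map_sub, m.hstar_δb h, m.hstar_iota h,
    SmoothFoliation.lich, SmoothFoliation.lmul, LinearMap.add_apply, map_neg, LinearMap.neg_apply]
  module

lemma lichδ_hstar (θ : X.Ω 1) {k l : ℕ} (h : k + (l + 1) = X.q) (α : X.Ω k) :
    X.lichδ m (m.κb - θ) l (m.hstar h α)
      = (-1 : ℝ) ^ (k + 1) •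
        m.hstar (show k + 1 + l = X.q by omega) (X.lich (-θ) k α) := by
  simp only [SmoothFoliation.lichδ, LinearMap.sub_apply, m.δb_hstar h, m.iota_hstar h,
    SmoothFoliation.lich, SmoothFoliation.lmul, LinearMap.add_apply, map_neg, map_sub, map_add,
    LinearMap.neg_apply]
  module

lemma hstar_lich_lichδ (θ : X.Ω 1) {k l : ℕ} (h : k + 1 + l = X.q) (α : X.Ω (k + 1)) :
    m.hstar h (X.lich (-θ) k (X.lichδ m θ k α))
      = X.lichδ m (m.κb - θ) l (X.lich (-(m.κb - θ)) l (m.hstar h α)) := by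
  have hδ := m.lichδ_hstar θ (show k + (l + 1) = X.q by omega) (X.lichδ m θ k α)
  rw [m.hstar_lichδ θ h, map_smul] at hδ
  exact (smul_right_injective _ (pow_ne_zero (k + 1) (by norm_num : (-1 : ℝ) ≠ 0)) hδ).symm

lemma hstar_lichδ_lich (θ : X.Ω 1) {k l : ℕ} (h : k + (l + 1) = X.q) (α : X.Ω k) :
    m.hstar h (X.lichδ m θ k (X.lich (-θ) k α))
      = X.lich (-(m.κb - θ)) l (X.lichδ m (m.κb - θ) l (m.hstar h α)) := by
  rw [m.lichδ_hstar θ h, map_smul]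
  exact m.hstar_lichδ θ (show k + 1 + l = X.q by omega) (X.lich (-θ) k α)

lemma hstar_lichLap (θ : X.Ω 1) {k l : ℕ} (h : k + l = X.q) (β : X.Ω k) :
    m.hstar h (X.lichLap m θ k β) = X.lichLap m (m.κb - θ) l (m.hstar h β) := by
  rcases k with _ | k <;> rcases l with _ | l <;>
    simp only [SmoothFoliation.lichLap, LinearMap.add_apply, LinearMap.comp_apply, map_add]
  · rw [X.degle _ (by omega) (X.lich (-θ) 0 β),
      X.degle _ (by omega) (X.lich (-(m.κb - θ)) 0 (m.hstar h β))]
    simp only [map_zero]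
  · rw [m.hstar_lichδ_lich θ h,
      X.degle _ (by omega) (X.lich (-(m.κb - θ)) (l + 1) (m.hstar h β)), map_zero, add_zero]
  · rw [m.hstar_lich_lichδ θ h, X.degle _ (by omega) (X.lich (-θ) (k + 1) β), map_zero,
      map_zero, add_zero]
  · rw [m.hstar_lich_lichδ θ h, m.hstar_lichδ_lich θ h]
    exact add_comm _ _

end BundleLikeMetric

/-- the transversal Hodge star intertwines the Lichnerowicz
Laplacians.  Let `(M,𝓕)` be a transversely oriented Riemannian foliation of
codimension `q` on a closed manifold with a bundle-like metric, let `θ` be a closed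
basic one-form, and let `Δ_θ = (δ_b − θ⌟)(d − θ∧) + (d − θ∧)(δ_b − θ⌟)` be the
Lichnerowicz Laplacian on basic forms.  Then for every basic `k`-form `β`,
`∗̄ Δ_θ β = Δ_{κ_b−θ} ∗̄ β`; hence `∗̄` maps the `Δ_θ`-harmonic basic `k`-forms
bijectively onto the `Δ_{κ_b−θ}`-harmonic basic `(q−k)`-forms. -/
theorem hstar_intertwines_lichnerowicz_laplacians
    (X : SmoothFoliation) (m : BundleLikeMetric X)
    (θ : X.Ω 1) (hθ : X.d 1 θ = 0)
    (k l : ℕ) (h : k + l = X.q) :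
    (∀ β : X.Ω k,
      m.hstar h (X.lichLap m θ k β) = X.lichLap m (m.κb - θ) l (m.hstar h β)) ∧
    Submodule.map (m.hstar h).toLinearMap (LinearMap.ker (X.lichLap m θ k))
      = LinearMap.ker (X.lichLap m (m.κb - θ) l) := by
  refine ⟨m.hstar_lichLap θ h, ?_⟩
  ext γ
  obtain ⟨β, rfl⟩ := (m.hstar h).surjective γ
  simp [← m.hstar_lichLap θ h]
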